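/- arXiv:1005.5644 — 8 statements merged into one kernel-verified Lean document; each statement's English description precedes it below -/
import Mathlib

section
/- Let V = V(S, L, H) be the Belavkin matrix with block entries V_{00} = 1, V_{0•} = -L†S, V_{00′} = -(1/2)L†L - iH, V_{•0} = 0, V_{••} = S, V_{•0′} = L, V_{0′0} = 0, V_{0′•} = 0, V_{0′0′} = 1, where S is a unitary element of 𝔅^{n×n}, L is a column vector of length n with entries in 𝔅, and H ∈ 𝔅 is self-adjoint. Then V is ⋆-unitary, i.e. V V⋆ = 𝕀 = V⋆ V. -/
/-!
STATEMENT 0: the Hudson–Parthasarathy Belavkin matrix `V(S, L, H)` built from a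
unitary `S ∈ 𝔅^{n×n}`, a column vector `L` over `𝔅` and a self-adjoint `H ∈ 𝔅`
(where `𝔅 = H₀ →L[ℂ] H₀`) is `⋆`-unitary: `V V⋆ = 𝕀 = V⋆ V`.
-/

noncomputable section

open scoped BigOperators Matrix

/-- The Belavkin index set `{0} ⊕ {1,…,n} ⊕ {0′}`. -/
abbrev BIdx (ι : Type*) : Type _ := Unit ⊕ ι ⊕ Unit

/-- The Belavkin `J` matrix: identity of the ring in positions `(0,0′)` and `(0′,0)`,
the identity in the middle block, and `0` elsewhere. -/
def Jmat (R : Type*) [Zero R] [One R] (ι : Type*) [DecidableEq ι] :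
    Matrix (BIdx ι) (BIdx ι) R :=
  Matrix.of fun p q =>
    match p, q with
    | Sum.inl _, Sum.inr (Sum.inr _) => (1 : R)
    | Sum.inr (Sum.inr _), Sum.inl _ => 1
    | Sum.inr (Sum.inl j), Sum.inr (Sum.inl k) => if j = k then 1 else 0
    | _, _ => 0

/-- The `⋆`-involution of a Belavkin matrix: `𝕏⋆ := J 𝕏† J`. -/
def bstar {R : Type*} [Semiring R] [StarRing R] {ι : Type*} [Fintype ι] [DecidableEq ι]
    (X : Matrix (BIdx ι) (BIdx ι) R) : Matrix (BIdx ι) (BIdx ι) R :=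
  Jmat R ι * Xᴴ * Jmat R ι

variable {H₀ : Type*} [NormedAddCommGroup H₀] [InnerProductSpace ℂ H₀] [CompleteSpace H₀]

/-- The Hudson–Parthasarathy Belavkin matrix `V(S, L, H)`, with blocks
`V₀₀ = 1`, `V₀• = -L†S`, `V₀₀′ = -(1/2)L†L - iH`, `V•₀ = 0`, `V•• = S`, `V•₀′ = L`,
`V₀′₀ = 0`, `V₀′• = 0`, `V₀′₀′ = 1`. -/
def HPmat {ι : Type*} [Fintype ι] (S : Matrix ι ι (H₀ →L[ℂ] H₀)) (L : ι → H₀ →L[ℂ] H₀)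
    (H : H₀ →L[ℂ] H₀) : Matrix (BIdx ι) (BIdx ι) (H₀ →L[ℂ] H₀) :=
  Matrix.of fun p q =>
    match p, q with
    | Sum.inl _, Sum.inl _ => 1
    | Sum.inl _, Sum.inr (Sum.inl k) => -∑ j, star (L j) * S j k
    | Sum.inl _, Sum.inr (Sum.inr _) =>
        (-(1 / 2 : ℂ)) • (∑ j, star (L j) * L j) - Complex.I • H
    | Sum.inr (Sum.inl j), Sum.inr (Sum.inl k) => S j k
    | Sum.inr (Sum.inl j), Sum.inr (Sum.inr _) => L j
    | Sum.inr (Sum.inr _), Sum.inr (Sum.inr _) => 1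
    | _, _ => 0

/-- The involution of the Belavkin index set exchanging `0` and `0′`. -/
def BIdx.swap {ι : Type*} : BIdx ι → BIdx ι
  | Sum.inl u => Sum.inr (Sum.inr u)
  | Sum.inr (Sum.inl j) => Sum.inr (Sum.inl j)
  | Sum.inr (Sum.inr u) => Sum.inl u

lemma Jmat_mul_apply {R : Type*} [Semiring R] {ι : Type*} [Fintype ι] [DecidableEq ι]
    (X : Matrix (BIdx ι) (BIdx ι) R) (p q : BIdx ι) :
    (Jmat R ι * X) p q = X p.swap q := by
  rcases p with _ | j | _ <;> simp [Matrix.mul_apply, Jmat, BIdx.swap]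

lemma mul_Jmat_apply {R : Type*} [Semiring R] {ι : Type*} [Fintype ι] [DecidableEq ι]
    (X : Matrix (BIdx ι) (BIdx ι) R) (p q : BIdx ι) :
    (X * Jmat R ι) p q = X p q.swap := by
  rcases q with _ | j | _ <;> simp [Matrix.mul_apply, Jmat, BIdx.swap]

lemma bstar_apply {R : Type*} [Semiring R] [StarRing R] {ι : Type*} [Fintype ι] [DecidableEq ι]
    (X : Matrix (BIdx ι) (BIdx ι) R) (p q : BIdx ι) :
    bstar X p q = star (X q.swap p.swap) := by
  rw [bstar, mul_Jmat_apply, Jmat_mul_apply, Matrix.conjTranspose_apply]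

lemma sum_star_mul_mul_star {R : Type*} [Semiring R] [StarRing R] {ι : Type*} [Fintype ι]
    [DecidableEq ι] {S : Matrix ι ι R} (hS : S * Sᴴ = 1) (L : ι → R) (i : ι) :
    ∑ k, (∑ j, star (L j) * S j k) * star (S i k) = star (L i) := by
  have h := congrFun (Matrix.vecMul_vecMul (star L) S Sᴴ) i
  rw [hS, Matrix.vecMul_one] at h
  simpa [Matrix.vecMul, dotProduct] using h

lemma sum_mul_sum_star_mul {R : Type*} [Semiring R] [StarRing R] {ι : Type*} [Fintype ι]
    [DecidableEq ι] {S : Matrix ι ι R} (hS : S * Sᴴ = 1) (L : ι → R) (i : ι) :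
    ∑ k, S i k * ∑ j, star (S j k) * L j = L i := by
  simpa [star_sum] using congrArg star (sum_star_mul_mul_star hS L i)

lemma sum_star_mul_mul_sum_star_mul {R : Type*} [Semiring R] [StarRing R] {ι : Type*} [Fintype ι]
    [DecidableEq ι] {S : Matrix ι ι R} (hS : S * Sᴴ = 1) (L : ι → R) :
    ∑ k, (∑ j, star (L j) * S j k) * ∑ j, star (S j k) * L j = ∑ j, star (L j) * L j := by
  simp_rw [Finset.mul_sum]
  rw [Finset.sum_comm]
  refine Finset.sum_congr rfl fun i _ => ?_
  simp_rw [← mul_assoc, ← Finset.sum_mul]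
  rw [sum_star_mul_mul_star hS]

/-- For self-adjoint `A` and `H`, the operator `-(1/2) A - i H` and its adjoint sum to `-A`. -/
lemma star_add_self_neg_half_smul_sub_I_smul {A H : H₀ →L[ℂ] H₀} (hA : star A = A)
    (hH : star H = H) :
    star ((-(1 / 2 : ℂ)) • A - Complex.I • H) + ((-(1 / 2 : ℂ)) • A - Complex.I • H) = -A := by
  simp only [star_sub, star_smul, hA, hH, star_neg, Complex.star_def, map_div₀, map_one,
    map_ofNat, Complex.conj_I]
  module

/-- If `S` is unitary, `H` is self-adjoint, then `V(S,L,H)` is `⋆`-unitary. -/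
theorem HPmat_star_unitary (n : ℕ) (hn : 1 ≤ n)
    (S : Matrix (Fin n) (Fin n) (H₀ →L[ℂ] H₀)) (L : Fin n → H₀ →L[ℂ] H₀)
    (H : H₀ →L[ℂ] H₀)
    (hS₁ : S * Sᴴ = 1) (hS₂ : Sᴴ * S = 1) (hH : IsSelfAdjoint H) :
    HPmat S L H * bstar (HPmat S L H) = 1 ∧
      bstar (HPmat S L H) * HPmat S L H = 1 := by
  have hA : star (∑ j, star (L j) * L j) = ∑ j, star (L j) * L j := by simp [star_sum]
  have hK := star_add_self_neg_half_smul_sub_I_smul hA hH.star_eq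
  have hK' := (add_comm _ _).trans hK
  have hS₁' (i j : Fin n) : ∑ k, S i k * star (S j k) = (1 : Matrix _ _ (H₀ →L[ℂ] H₀)) i j := by
    simpa [Matrix.mul_apply] using congrFun₂ hS₁ i j
  have hS₂' (i j : Fin n) : ∑ k, star (S k i) * S k j = (1 : Matrix _ _ (H₀ →L[ℂ] H₀)) i j := by
    simpa [Matrix.mul_apply] using congrFun₂ hS₂ i j
  constructor
  · ext1 p q
    rw [Matrix.mul_apply]
    simp only [bstar_apply, Fintype.sum_sum_type]
    rcases p with _ | i | _ <;> rcases q with _ | j | _ <;>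
      simp [HPmat, BIdx.swap, Matrix.one_apply, -one_div, -star_sub, -star_smul, -neg_smul, hS₁',
        star_sum, sum_star_mul_mul_star hS₁, sum_mul_sum_star_mul hS₁,
        sum_star_mul_mul_sum_star_mul hS₁]
    rw [add_left_comm, hK, add_neg_cancel]
  · ext1 p q
    rw [Matrix.mul_apply]
    simp only [bstar_apply, Fintype.sum_sum_type]
    rcases p with _ | i | _ <;> rcases q with _ | j | _ <;>
      simp [HPmat, BIdx.swap, Matrix.one_apply, -one_div, -star_sub, -star_smul, -neg_smul, hS₂',
        star_sum]
    rw [add_left_comm, hK', add_neg_cancel]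
end
end

section
/- Let V be a Belavkin matrix of the form with block entries V_{00} = 1, V_{0•} = A (a row vector over 𝔅), V_{00′} = B ∈ 𝔅, V_{•0} = 0, V_{••} = S ∈ 𝔅^{n×n}, V_{•0′} = L (a column vector over 𝔅), V_{0′0} = 0, V_{0′•} = 0, V_{0′0′} = 1. If V is ⋆-unitary (V V⋆ = 𝕀 = V⋆ V), then S is unitary in 𝔅^{n×n}, A = -L†S, and B + B* = -L†L; equivalently, H := (i/2)(B - B*) is self-adjoint and B = -(1/2)L†L - iH. -/
/-!
STATEMENT 1: a `⋆`-unitary Belavkin matrix with blocks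
`V₀₀ = 1`, `V₀• = A`, `V₀₀′ = B`, `V•₀ = 0`, `V•• = S`, `V•₀′ = L`,
`V₀′₀ = 0`, `V₀′• = 0`, `V₀′₀′ = 1` necessarily has `S` unitary, `A = -L†S`,
`B + B* = -L†L`; moreover `H := (i/2)(B - B*)` is self-adjoint and
`B = -(1/2)L†L - iH`.
-/

noncomputable section

open scoped BigOperators Matrix

variable {H₀ : Type*} [NormedAddCommGroup H₀] [InnerProductSpace ℂ H₀] [CompleteSpace H₀]

/-- A Belavkin matrix with prescribed first row `(1, A, B)`, middle rows `(0, S, L)` and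
last row `(0, 0, 1)`. -/
def genV {ι : Type*} [Fintype ι] (A : ι → H₀ →L[ℂ] H₀) (B : H₀ →L[ℂ] H₀)
    (S : Matrix ι ι (H₀ →L[ℂ] H₀)) (L : ι → H₀ →L[ℂ] H₀) :
    Matrix (BIdx ι) (BIdx ι) (H₀ →L[ℂ] H₀) :=
  Matrix.of fun p q =>
    match p, q with
    | Sum.inl _, Sum.inl _ => 1
    | Sum.inl _, Sum.inr (Sum.inl k) => A k
    | Sum.inl _, Sum.inr (Sum.inr _) => B
    | Sum.inr (Sum.inl j), Sum.inr (Sum.inl k) => S j k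
    | Sum.inr (Sum.inl j), Sum.inr (Sum.inr _) => L j
    | Sum.inr (Sum.inr _), Sum.inr (Sum.inr _) => 1
    | _, _ => 0

theorem bstar_genV {ι : Type*} [Fintype ι] [DecidableEq ι] (A : ι → H₀ →L[ℂ] H₀)
    (B : H₀ →L[ℂ] H₀) (S : Matrix ι ι (H₀ →L[ℂ] H₀)) (L : ι → H₀ →L[ℂ] H₀) :
    bstar (genV A B S L) = genV (star L) (star B) Sᴴ (star A) := by
  ext1 p q
  rcases p with _ | _ | _ <;> rcases q with _ | _ | _ <;>
    simp [bstar, Jmat, genV, Matrix.mul_apply, Fintype.sum_sum_type]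

theorem genV_mul_genV {ι : Type*} [Fintype ι] (A A' : ι → H₀ →L[ℂ] H₀)
    (B B' : H₀ →L[ℂ] H₀) (S S' : Matrix ι ι (H₀ →L[ℂ] H₀)) (L L' : ι → H₀ →L[ℂ] H₀) :
    genV A B S L * genV A' B' S' L' =
      genV (fun k => A' k + ∑ j, A j * S' j k) (B' + (∑ j, A j * L' j + B)) (S * S')
        (fun j => ∑ k, S j k * L' k + L j) := by
  ext1 p q
  rcases p with _ | _ | _ <;> rcases q with _ | _ | _ <;>
    simp [genV, Matrix.mul_apply, Fintype.sum_sum_type]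

theorem eq_of_genV_eq_one {ι : Type*} [Fintype ι] [DecidableEq ι] {A : ι → H₀ →L[ℂ] H₀}
    {B : H₀ →L[ℂ] H₀} {S : Matrix ι ι (H₀ →L[ℂ] H₀)} {L : ι → H₀ →L[ℂ] H₀}
    (h : genV A B S L = 1) : (∀ k, A k = 0) ∧ B = 0 ∧ S = 1 := by
  refine ⟨fun k => ?_, ?_, ?_⟩
  · simpa [genV] using congrFun₂ h (Sum.inl ()) (Sum.inr (Sum.inl k))
  · simpa [genV] using congrFun₂ h (Sum.inl ()) (Sum.inr (Sum.inr ()))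
  · ext1 j k
    simpa [genV, Matrix.one_apply] using congrFun₂ h (Sum.inr (Sum.inl j)) (Sum.inr (Sum.inl k))

/-- If `V = genV A B S L` is `⋆`-unitary then `S` is unitary,
`A = -L†S`, `B + B* = -L†L`, `H := (i/2)(B - B*)` is self-adjoint, and
`B = -(1/2)L†L - iH`. -/
theorem star_unitary_implies_HP_form (n : ℕ) (hn : 1 ≤ n)
    (A : Fin n → H₀ →L[ℂ] H₀) (B : H₀ →L[ℂ] H₀)
    (S : Matrix (Fin n) (Fin n) (H₀ →L[ℂ] H₀)) (L : Fin n → H₀ →L[ℂ] H₀)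
    (hV₁ : genV A B S L * bstar (genV A B S L) = 1)
    (hV₂ : bstar (genV A B S L) * genV A B S L = 1) :
    (S * Sᴴ = 1 ∧ Sᴴ * S = 1) ∧
      (∀ k, A k = -∑ j, star (L j) * S j k) ∧
      (B + star B = -∑ j, star (L j) * L j) ∧
      IsSelfAdjoint ((Complex.I / 2) • (B - star B)) ∧
      B = (-(1 / 2 : ℂ)) • (∑ j, star (L j) * L j) -
        Complex.I • ((Complex.I / 2) • (B - star B)) := by
  rw [bstar_genV, genV_mul_genV] at hV₁ hV₂
  obtain ⟨-, -, hS₁⟩ := eq_of_genV_eq_one hV₁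
  obtain ⟨hA, hB, hS₂⟩ := eq_of_genV_eq_one hV₂
  simp only [Pi.star_apply] at hA hB
  have hBL : B + star B = -∑ j, star (L j) * L j := by
    rw [eq_neg_iff_add_eq_zero, ← hB]
    abel
  refine ⟨⟨hS₁, hS₂⟩, fun k => eq_neg_of_add_eq_zero_left (hA k), hBL, ?_, ?_⟩
  · rw [isSelfAdjoint_iff, star_smul, star_sub, star_star, ← neg_sub B (star B), smul_neg,
      ← neg_smul]
    congr 1
    simp [neg_div]
  · rw [← neg_eq_iff_eq_neg.mpr hBL, smul_smul,
      show Complex.I * (Complex.I / 2) = -(1 / 2 : ℂ) by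
        rw [← mul_div_assoc, Complex.I_mul_I, neg_div]]
    module
end
end

section
/- Let V₁ = V(S₁, L₁, H₁) and V₂ = V(S₂, L₂, H₂) be Belavkin matrices in Hudson-Parthasarathy form, with S₁, S₂ unitary in 𝔅^{n×n}, L₁, L₂ column vectors over 𝔅, and H₁, H₂ self-adjoint in 𝔅. Then the matrix product V₂ V₁ is again of Hudson-Parthasarathy form V(S_ser, L_ser, H_ser) with parameters S_ser = S₂S₁, L_ser = L₂ + S₂L₁, and H_ser = H₁ + H₂ + Im{L₂†S₂L₁}, where Im{Z} := (Z - Z*)/(2i). -/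
/-!
STATEMENT 2: the series product.  For two Hudson–Parthasarathy Belavkin matrices
`V(S₁,L₁,H₁)`, `V(S₂,L₂,H₂)` the matrix product `V₂ V₁` is again of
Hudson–Parthasarathy form, with parameters `S_ser = S₂S₁`, `L_ser = L₂ + S₂L₁`,
`H_ser = H₁ + H₂ + Im{L₂†S₂L₁}`, where `Im{Z} = (Z - Z*)/(2i)`.
-/

noncomputable section

open scoped BigOperators Matrix

variable {H₀ : Type*} [NormedAddCommGroup H₀] [InnerProductSpace ℂ H₀] [CompleteSpace H₀]

/-- The "imaginary part" `Im{Z} := (Z - Z*)/(2i)` of an operator. -/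
def imPart (Z : H₀ →L[ℂ] H₀) : H₀ →L[ℂ] H₀ := (2 * Complex.I)⁻¹ • (Z - star Z)

/-- An isometric matrix `S` satisfies `(S L)† S = L†`. -/
theorem star_mulVec_vecMul_of_conjTranspose_mul_self {ι R : Type*} [Fintype ι] [DecidableEq ι]
    [Ring R] [StarRing R] {S : Matrix ι ι R} (hS : Sᴴ * S = 1) (L : ι → R) :
    star (S *ᵥ L) ᵥ* S = star L := by
  rw [Matrix.star_mulVec, Matrix.vecMul_vecMul, hS, Matrix.vecMul_one]

/-- An isometric matrix `S` satisfies `(S L)† (S L) = L† L`. -/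
theorem star_mulVec_dotProduct_mulVec_of_conjTranspose_mul_self {ι R : Type*} [Fintype ι]
    [DecidableEq ι] [Ring R] [StarRing R] {S : Matrix ι ι R} (hS : Sᴴ * S = 1) (L : ι → R) :
    star (S *ᵥ L) ⬝ᵥ (S *ᵥ L) = star L ⬝ᵥ L := by
  rw [Matrix.dotProduct_mulVec, star_mulVec_vecMul_of_conjTranspose_mul_self hS]

/-- The row block of the series product:
`(L₂ + S₂ L₁)† S₂ S₁ = L₁† S₁ + (L₂† S₂) S₁`. -/
theorem star_add_mulVec_vecMul_mul {ι R : Type*} [Fintype ι] [DecidableEq ι]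
    [Ring R] [StarRing R] {S₂ : Matrix ι ι R} (hS₂ : S₂ᴴ * S₂ = 1) (S₁ : Matrix ι ι R)
    (L₁ L₂ : ι → R) :
    star (L₂ + S₂ *ᵥ L₁) ᵥ* (S₂ * S₁) = star L₁ ᵥ* S₁ + (star L₂ ᵥ* S₂) ᵥ* S₁ := by
  rw [← Matrix.vecMul_vecMul, star_add, Matrix.add_vecMul,
    star_mulVec_vecMul_of_conjTranspose_mul_self hS₂, Matrix.add_vecMul, add_comm]

/-- The quadratic term of the series product:
`(L₂ + S₂ L₁)† (L₂ + S₂ L₁) = L₂† L₂ + L₁† L₁ + Z + Z*` with `Z = L₂† S₂ L₁`. -/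
theorem star_add_mulVec_dotProduct_self {ι R : Type*} [Fintype ι] [DecidableEq ι]
    [Ring R] [StarRing R] {S : Matrix ι ι R} (hS : Sᴴ * S = 1) (L₁ L₂ : ι → R) :
    star (L₂ + S *ᵥ L₁) ⬝ᵥ (L₂ + S *ᵥ L₁) =
      star L₂ ⬝ᵥ L₂ + star L₁ ⬝ᵥ L₁ + (star L₂ ⬝ᵥ (S *ᵥ L₁) + star (star L₂ ⬝ᵥ (S *ᵥ L₁))) := by
  have hstar : star (star L₂ ⬝ᵥ (S *ᵥ L₁)) = star (S *ᵥ L₁) ⬝ᵥ L₂ := by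
    simp [dotProduct]
  rw [hstar, star_add, add_dotProduct, dotProduct_add, dotProduct_add,
    star_mulVec_dotProduct_mulVec_of_conjTranspose_mul_self hS]
  abel

/-- The drift term `Z = L₂† S₂ L₁` splits into `(Z + Z*) / 2` and `i Im Z`. -/
theorem I_smul_imPart (Z : H₀ →L[ℂ] H₀) :
    Complex.I • imPart Z = (1 / 2 : ℂ) • (Z - star Z) := by
  rw [imPart, smul_smul]
  congr 1
  field_simp

/-- The series product: `V(S₂,L₂,H₂) V(S₁,L₁,H₁)` is the
Hudson–Parthasarathy matrix with parameters `(S₂S₁, L₂ + S₂L₁, H₁ + H₂ + Im{L₂†S₂L₁})`. -/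
theorem HPmat_mul_HPmat (n : ℕ) (hn : 1 ≤ n)
    (S₁ S₂ : Matrix (Fin n) (Fin n) (H₀ →L[ℂ] H₀)) (L₁ L₂ : Fin n → H₀ →L[ℂ] H₀)
    (H₁ H₂ : H₀ →L[ℂ] H₀)
    (hS₁ : S₁ * S₁ᴴ = 1) (hS₁' : S₁ᴴ * S₁ = 1)
    (hS₂ : S₂ * S₂ᴴ = 1) (hS₂' : S₂ᴴ * S₂ = 1)
    (hH₁ : IsSelfAdjoint H₁) (hH₂ : IsSelfAdjoint H₂) :
    HPmat S₂ L₂ H₂ * HPmat S₁ L₁ H₁ =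
      HPmat (S₂ * S₁) (fun j => L₂ j + ∑ k, S₂ j k * L₁ k)
        (H₁ + H₂ + imPart (∑ j, ∑ k, star (L₂ j) * (S₂ j k * L₁ k))) := by
  have hZ : ∑ j, ∑ k, star (L₂ j) * (S₂ j k * L₁ k) = star L₂ ⬝ᵥ (S₂ *ᵥ L₁) := by
    simp [dotProduct, Matrix.mulVec, Finset.mul_sum]
  have hL : (fun j => L₂ j + ∑ k, S₂ j k * L₁ k) = L₂ + S₂ *ᵥ L₁ := rfl
  rw [hZ, hL]
  ext1 p q
  rcases p with _ | j | _ <;> rcases q with _ | k | _ <;>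
    simp only [Matrix.mul_apply, Fintype.sum_sum_type, Finset.univ_unique, Finset.sum_singleton,
      HPmat, Matrix.of_apply, mul_zero, zero_mul, mul_one, one_mul, add_zero, zero_add,
      Finset.sum_const_zero]
  · have h := congrFun (star_add_mulVec_vecMul_mul hS₂' S₁ L₁ L₂) k
    change -(star L₁ ᵥ* S₁) k + ((-(star L₂ ᵥ* S₂)) ᵥ* S₁) k =
      -(star (L₂ + S₂ *ᵥ L₁) ᵥ* (S₂ * S₁)) k
    rw [h, Matrix.neg_vecMul, Pi.neg_apply, Pi.add_apply, neg_add]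
  · change (-(1 / 2 : ℂ)) • (star L₁ ⬝ᵥ L₁) - Complex.I • H₁ +
        ((-(star L₂ ᵥ* S₂)) ⬝ᵥ L₁ + ((-(1 / 2 : ℂ)) • (star L₂ ⬝ᵥ L₂) - Complex.I • H₂)) =
      (-(1 / 2 : ℂ)) • (star (L₂ + S₂ *ᵥ L₁) ⬝ᵥ (L₂ + S₂ *ᵥ L₁)) -
        Complex.I • (H₁ + H₂ + imPart (star L₂ ⬝ᵥ (S₂ *ᵥ L₁)))
    rw [star_add_mulVec_dotProduct_self hS₂', smul_add Complex.I, I_smul_imPart, neg_dotProduct,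
      ← Matrix.dotProduct_mulVec]
    module
  · exact add_comm _ _
end
end

section
/- The series product on Hudson-Parthasarathy triples, defined by (S₂, L₂, H₂) ◁ (S₁, L₁, H₁) := (S₂S₁, L₂ + S₂L₁, H₁ + H₂ + Im{L₂†S₂L₁}) where Im{Z} := (Z - Z*)/(2i), is associative: for any three triples (Sₖ, Lₖ, Hₖ), k = 1, 2, 3, with Sₖ ∈ 𝔅^{n×n} unitary, Lₖ length-n column vectors over 𝔅, and Hₖ ∈ 𝔅 self-adjoint, one has ((S₃,L₃,H₃) ◁ (S₂,L₂,H₂)) ◁ (S₁,L₁,H₁) = (S₃,L₃,H₃) ◁ ((S₂,L₂,H₂) ◁ (S₁,L₁,H₁)). -/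
/-!
STATEMENT 3: the series product
`(S₂,L₂,H₂) ◁ (S₁,L₁,H₁) := (S₂S₁, L₂ + S₂L₁, H₁ + H₂ + Im{L₂†S₂L₁})`
on Hudson–Parthasarathy triples is associative.
-/

noncomputable section

open scoped BigOperators Matrix

variable {H₀ : Type*} [NormedAddCommGroup H₀] [InnerProductSpace ℂ H₀] [CompleteSpace H₀]

/-- The series product on Hudson–Parthasarathy triples `(S, L, H)`:
`(S₂,L₂,H₂) ◁ (S₁,L₁,H₁) := (S₂S₁, L₂ + S₂L₁, H₁ + H₂ + Im{L₂†S₂L₁})`. -/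
def seriesProd {n : ℕ}
    (T₂ T₁ : Matrix (Fin n) (Fin n) (H₀ →L[ℂ] H₀) × (Fin n → H₀ →L[ℂ] H₀) × (H₀ →L[ℂ] H₀)) :
    Matrix (Fin n) (Fin n) (H₀ →L[ℂ] H₀) × (Fin n → H₀ →L[ℂ] H₀) × (H₀ →L[ℂ] H₀) :=
  (T₂.1 * T₁.1,
    fun j => T₂.2.1 j + ∑ k, T₂.1 j k * T₁.2.1 k,
    T₁.2.2 + T₂.2.2 + imPart (∑ j, ∑ k, star (T₂.2.1 j) * (T₂.1 j k * T₁.2.1 k)))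

open Matrix in
/-- The series product in terms of matrix-vector and dot products. -/
theorem seriesProd_eq_mulVec {n : ℕ} (S₁ S₂ : Matrix (Fin n) (Fin n) (H₀ →L[ℂ] H₀))
    (L₁ L₂ : Fin n → H₀ →L[ℂ] H₀) (H₁ H₂ : H₀ →L[ℂ] H₀) :
    seriesProd (S₂, L₂, H₂) (S₁, L₁, H₁) =
      (S₂ * S₁, L₂ + S₂ *ᵥ L₁, H₁ + H₂ + imPart (star L₂ ⬝ᵥ S₂ *ᵥ L₁)) := by
  simp only [seriesProd, dotProduct, mulVec, Finset.mul_sum, Pi.star_apply, Prod.mk.injEq,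
    and_true, true_and]
  rfl

theorem imPart_add (Z W : H₀ →L[ℂ] H₀) : imPart (Z + W) = imPart Z + imPart W := by
  simp only [imPart, star_add, add_sub_add_comm, smul_add]

open Matrix in
/-- A matrix `A` with `Aᴴ * A = 1` preserves the sesquilinear pairing of column vectors. -/
theorem star_mulVec_dotProduct_mulVec {m R : Type*} [Fintype m] [DecidableEq m] [Ring R]
    [StarRing R] {A : Matrix m m R} (hA : Aᴴ * A = 1) (v w : m → R) :
    star (A *ᵥ v) ⬝ᵥ A *ᵥ w = star v ⬝ᵥ w := by
  rw [star_mulVec, dotProduct_mulVec, vecMul_vecMul, hA, vecMul_one]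

/-- The series product is associative on Hudson–Parthasarathy triples. -/
theorem seriesProd_assoc (n : ℕ) (hn : 1 ≤ n)
    (S₁ S₂ S₃ : Matrix (Fin n) (Fin n) (H₀ →L[ℂ] H₀))
    (L₁ L₂ L₃ : Fin n → H₀ →L[ℂ] H₀) (H₁ H₂ H₃ : H₀ →L[ℂ] H₀)
    (hS₁ : S₁ * S₁ᴴ = 1) (hS₁' : S₁ᴴ * S₁ = 1)
    (hS₂ : S₂ * S₂ᴴ = 1) (hS₂' : S₂ᴴ * S₂ = 1)
    (hS₃ : S₃ * S₃ᴴ = 1) (hS₃' : S₃ᴴ * S₃ = 1)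
    (hH₁ : IsSelfAdjoint H₁) (hH₂ : IsSelfAdjoint H₂) (hH₃ : IsSelfAdjoint H₃) :
    seriesProd (seriesProd (S₃, L₃, H₃) (S₂, L₂, H₂)) (S₁, L₁, H₁) =
      seriesProd (S₃, L₃, H₃) (seriesProd (S₂, L₂, H₂) (S₁, L₁, H₁)) := by
  simp only [seriesProd_eq_mulVec, Prod.mk.injEq]
  refine ⟨mul_assoc _ _ _, ?_, ?_⟩
  · rw [Matrix.mulVec_add, Matrix.mulVec_mulVec, add_assoc]
  · rw [star_add, add_dotProduct, ← Matrix.mulVec_mulVec L₁ S₃ S₂,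
      star_mulVec_dotProduct_mulVec hS₃', Matrix.mulVec_add, dotProduct_add, imPart_add,
      imPart_add]
    abel
end
end

section
/- Let V be a ⋆-unitary (1+n+1)×(1+n+1) Belavkin matrix over 𝔅, with the middle index set {1,…,n} partitioned into external indices e of size n_e and internal indices i of size n_i, where 0 < n_i < n and n_e = n - n_i. Let X be a unitary n_i×n_i complex matrix (regarded as having entries in 𝔅 via scalar multiples of the identity) such that 1 - V_{ii}X is invertible in 𝔅^{n_i×n_i}. Define the (1+n_e+1)×(1+n_e+1) Belavkin matrix 𝓕(V, X) by the block formula 𝓕(V, X)_{αβ} = V_{αβ} + V_{αi} X (1 - V_{ii}X)^{-1} V_{iβ} for α, β ∈ {0} ∪ e ∪ {0′}. Then 𝓕(V, X) is ⋆-unitary: 𝓕(V,X) 𝓕(V,X)⋆ = 𝕀 = 𝓕(V,X)⋆ 𝓕(V,X), where ⋆ is taken with respect to J_{n_e}. -/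
noncomputable section

open scoped BigOperators Matrix

/-- Embedding of the reduced (external) Belavkin index set into the full one,
relative to the partition `{1,…,n} = e ⊔ i`. -/
def embE {ne ni : ℕ} : BIdx (Fin ne) → BIdx (Fin ne ⊕ Fin ni)
  | Sum.inl u => Sum.inl u
  | Sum.inr (Sum.inl e) => Sum.inr (Sum.inl (Sum.inl e))
  | Sum.inr (Sum.inr u) => Sum.inr (Sum.inr u)

/-- Embedding of an internal index into the full Belavkin index set. -/
def intI {ne ni : ℕ} (j : Fin ni) : BIdx (Fin ne ⊕ Fin ni) :=
  Sum.inr (Sum.inl (Sum.inr j))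

/-- The internal-internal sub-block `V_ii`. -/
def blkII {R : Type*} {ne ni : ℕ}
    (V : Matrix (BIdx (Fin ne ⊕ Fin ni)) (BIdx (Fin ne ⊕ Fin ni)) R) :
    Matrix (Fin ni) (Fin ni) R :=
  Matrix.of fun j k => V (intI j) (intI k)

/-- The block column `V_{αi}`, `α ∈ {0} ∪ e ∪ {0′}` (i.e. `(V_0i; V_ei; V_0′i)`). -/
def blkEI {R : Type*} {ne ni : ℕ}
    (V : Matrix (BIdx (Fin ne ⊕ Fin ni)) (BIdx (Fin ne ⊕ Fin ni)) R) :
    Matrix (BIdx (Fin ne)) (Fin ni) R :=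
  Matrix.of fun a j => V (embE a) (intI j)

/-- The block row `V_{iβ}`, `β ∈ {0} ∪ e ∪ {0′}` (i.e. `(V_i0, V_ie, V_i0′)`). -/
def blkIE {R : Type*} {ne ni : ℕ}
    (V : Matrix (BIdx (Fin ne ⊕ Fin ni)) (BIdx (Fin ne ⊕ Fin ni)) R) :
    Matrix (Fin ni) (BIdx (Fin ne)) R :=
  Matrix.of fun j b => V (intI j) (embE b)

/-- The external sub-matrix `V_{αβ}`, `α, β ∈ {0} ∪ e ∪ {0′}`. -/
def blkEE {R : Type*} {ne ni : ℕ}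
    (V : Matrix (BIdx (Fin ne ⊕ Fin ni)) (BIdx (Fin ne ⊕ Fin ni)) R) :
    Matrix (BIdx (Fin ne)) (BIdx (Fin ne)) R :=
  Matrix.of fun a b => V (embE a) (embE b)

variable {H₀ : Type*} [NormedAddCommGroup H₀] [InnerProductSpace ℂ H₀] [CompleteSpace H₀]

/-- The Gough–James feedback reduction
`𝓕(V, X)_{αβ} = V_{αβ} + V_{αi} X (1 - V_{ii}X)⁻¹ V_{iβ}` of a Belavkin matrix `V`
by a complex `n_i × n_i` matrix `X` (regarded in `𝔅` via `algebraMap`). -/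
def FRed {ne ni : ℕ}
    (V : Matrix (BIdx (Fin ne ⊕ Fin ni)) (BIdx (Fin ne ⊕ Fin ni)) (H₀ →L[ℂ] H₀))
    (X : Matrix (Fin ni) (Fin ni) ℂ) :
    Matrix (BIdx (Fin ne)) (BIdx (Fin ne)) (H₀ →L[ℂ] H₀) :=
  blkEE V + blkEI V * X.map (algebraMap ℂ (H₀ →L[ℂ] H₀)) *
    Ring.inverse (1 - blkII V * X.map (algebraMap ℂ (H₀ →L[ℂ] H₀))) * blkIE V

/-- The permutation of the Belavkin index set exchanging `0` and `0′`. -/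
def swapEnds {ι : Type*} : BIdx ι → BIdx ι
  | Sum.inl u => Sum.inr (Sum.inr u)
  | Sum.inr (Sum.inl j) => Sum.inr (Sum.inl j)
  | Sum.inr (Sum.inr u) => Sum.inl u

theorem swapEnds_embE {ne ni : ℕ} (a : BIdx (Fin ne)) :
    swapEnds (embE a : BIdx (Fin ne ⊕ Fin ni)) = embE (swapEnds a) := by
  rcases a with _ | _ | _ <;> rfl

theorem swapEnds_intI {ne ni : ℕ} (j : Fin ni) :
    swapEnds (intI j : BIdx (Fin ne ⊕ Fin ni)) = intI j := rfl

section Jmat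

variable {R ι κ : Type*} [Semiring R] [Fintype ι] [DecidableEq ι]

theorem Jmat_mul_apply_s4 (M : Matrix (BIdx ι) κ R) (a : BIdx ι) (b : κ) :
    (Jmat R ι * M) a b = M (swapEnds a) b := by
  rcases a with _ | _ | _ <;>
    simp [Matrix.mul_apply, Fintype.sum_sum_type, Jmat, swapEnds]

theorem mul_Jmat_apply_s4 (M : Matrix κ (BIdx ι) R) (a : κ) (b : BIdx ι) :
    (M * Jmat R ι) a b = M a (swapEnds b) := by
  rcases b with _ | _ | _ <;>
    simp [Matrix.mul_apply, Fintype.sum_sum_type, Jmat, swapEnds]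

theorem bstar_apply_s4 [StarRing R] (M : Matrix (BIdx ι) (BIdx ι) R) (a b : BIdx ι) :
    bstar M a b = star (M (swapEnds b) (swapEnds a)) := by
  rw [bstar, mul_Jmat_apply_s4, Jmat_mul_apply_s4, Matrix.conjTranspose_apply]

end Jmat

section Blocks

variable {R : Type*} {ne ni : ℕ}

theorem sum_BIdx_eq_sum_embE_add_sum_intI [AddCommMonoid R]
    (f : BIdx (Fin ne ⊕ Fin ni) → R) :
    ∑ x, f x = ∑ a : BIdx (Fin ne), f (embE a) + ∑ j : Fin ni, f (intI j) := by
  simp only [Fintype.sum_sum_type, embE, intI]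
  abel

section Mul

variable [Semiring R] (V W : Matrix (BIdx (Fin ne ⊕ Fin ni)) (BIdx (Fin ne ⊕ Fin ni)) R)

theorem blkEE_mul : blkEE (V * W) = blkEE V * blkEE W + blkEI V * blkIE W := by
  ext a b
  exact sum_BIdx_eq_sum_embE_add_sum_intI fun x => V (embE a) x * W x (embE b)

theorem blkEI_mul : blkEI (V * W) = blkEE V * blkEI W + blkEI V * blkII W := by
  ext a b
  exact sum_BIdx_eq_sum_embE_add_sum_intI fun x => V (embE a) x * W x (intI b)

theorem blkIE_mul : blkIE (V * W) = blkIE V * blkEE W + blkII V * blkIE W := by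
  ext a b
  exact sum_BIdx_eq_sum_embE_add_sum_intI fun x => V (intI a) x * W x (embE b)

theorem blkII_mul : blkII (V * W) = blkIE V * blkEI W + blkII V * blkII W := by
  ext a b
  exact sum_BIdx_eq_sum_embE_add_sum_intI fun x => V (intI a) x * W x (intI b)

end Mul

section One

variable [Zero R] [One R]

theorem blkEE_one :
    blkEE (1 : Matrix (BIdx (Fin ne ⊕ Fin ni)) (BIdx (Fin ne ⊕ Fin ni)) R) = 1 := by
  ext (_ | _ | _) (_ | _ | _) <;> simp [blkEE, embE, Matrix.one_apply]

theorem blkEI_one :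
    blkEI (1 : Matrix (BIdx (Fin ne ⊕ Fin ni)) (BIdx (Fin ne ⊕ Fin ni)) R) = 0 := by
  ext (_ | _ | _) _ <;> simp [blkEI, embE, intI, Matrix.one_apply]

theorem blkIE_one :
    blkIE (1 : Matrix (BIdx (Fin ne ⊕ Fin ni)) (BIdx (Fin ne ⊕ Fin ni)) R) = 0 := by
  ext _ (_ | _ | _) <;> simp [blkIE, embE, intI, Matrix.one_apply]

theorem blkII_one :
    blkII (1 : Matrix (BIdx (Fin ne ⊕ Fin ni)) (BIdx (Fin ne ⊕ Fin ni)) R) = 1 := by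
  ext _ _
  simp [blkII, intI, Matrix.one_apply]

end One

section Star

variable [Semiring R] [StarRing R]
  (V : Matrix (BIdx (Fin ne ⊕ Fin ni)) (BIdx (Fin ne ⊕ Fin ni)) R)

theorem blkEE_bstar : blkEE (bstar V) = bstar (blkEE V) := by
  ext a b
  simp [blkEE, bstar_apply_s4, swapEnds_embE]

theorem blkEI_bstar : blkEI (bstar V) = Jmat R (Fin ne) * (blkIE V)ᴴ := by
  ext a j
  simp [blkEI, blkIE, bstar_apply_s4, Jmat_mul_apply_s4, swapEnds_embE, swapEnds_intI]

theorem blkIE_bstar : blkIE (bstar V) = (blkEI V)ᴴ * Jmat R (Fin ne) := by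
  ext j b
  simp [blkEI, blkIE, bstar_apply_s4, mul_Jmat_apply_s4, swapEnds_embE, swapEnds_intI]

theorem blkII_bstar : blkII (bstar V) = (blkII V)ᴴ := by
  ext j k
  simp [blkII, bstar_apply_s4, swapEnds_intI]

end Star

/-- If `W` is a right inverse of `V`, then so are their feedback reductions with gains
`P = (Y - V_ii)⁻¹` and `Q = (X - W_ii)⁻¹`, where `Y * X = 1`. -/
theorem blk_feedback_mul_eq_one [Ring R]
    {V W : Matrix (BIdx (Fin ne ⊕ Fin ni)) (BIdx (Fin ne ⊕ Fin ni)) R} (hVW : V * W = 1)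
    {X Y P Q : Matrix (Fin ni) (Fin ni) R} (hYX : Y * X = 1)
    (hP : P * (Y - blkII V) = 1) (hQ : (X - blkII W) * Q = 1) :
    (blkEE V + blkEI V * P * blkIE V) * (blkEE W + blkEI W * Q * blkIE W) = 1 := by
  have h₁ : blkEE V * blkEE W = 1 - blkEI V * blkIE W := by
    rw [eq_sub_iff_add_eq, ← blkEE_mul, hVW, blkEE_one]
  have h₂ : blkEE V * blkEI W = -(blkEI V * blkII W) := by
    rw [eq_neg_iff_add_eq_zero, ← blkEI_mul, hVW, blkEI_one]
  have h₃ : blkIE V * blkEE W = -(blkII V * blkIE W) := by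
    rw [eq_neg_iff_add_eq_zero, ← blkIE_mul, hVW, blkIE_one]
  have h₄ : blkIE V * blkEI W = 1 - blkII V * blkII W := by
    rw [eq_sub_iff_add_eq, ← blkII_mul, hVW, blkII_one]
  have key : -1 - blkII W * Q - P * blkII V + P * (1 - blkII V * blkII W) * Q = 0 := by
    calc _ = -((P * (Y - blkII V)) * ((X - blkII W) * Q))
          - (P * (Y - blkII V)) * (blkII W * Q) - (P * blkII V) * ((X - blkII W) * Q)
          + P * (1 - blkII V * blkII W) * Q := by rw [hP, hQ]; noncomm_ring
      _ = P * (1 - Y * X) * Q := by noncomm_ring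
      _ = 0 := by rw [hYX]; simp
  calc _ = blkEE V * blkEE W + (blkEE V * blkEI W) * (Q * blkIE W)
        + blkEI V * P * (blkIE V * blkEE W)
        + blkEI V * P * (blkIE V * blkEI W) * (Q * blkIE W) := by
        simp only [Matrix.mul_add, Matrix.add_mul, Matrix.mul_assoc]; abel
    _ = 1 + blkEI V * (-1 - blkII W * Q - P * blkII V
        + P * (1 - blkII V * blkII W) * Q) * blkIE W := by
        rw [h₁, h₂, h₃, h₄]
        simp only [Matrix.mul_add, Matrix.add_mul, Matrix.mul_sub, Matrix.sub_mul,
          Matrix.mul_neg, Matrix.neg_mul, Matrix.mul_one, Matrix.mul_assoc]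
        abel
    _ = 1 := by rw [key]; simp

end Blocks

theorem bstar_blk_feedback {R : Type*} [Semiring R] [StarRing R] {ne ni : ℕ}
    (V : Matrix (BIdx (Fin ne ⊕ Fin ni)) (BIdx (Fin ne ⊕ Fin ni)) R)
    (P : Matrix (Fin ni) (Fin ni) R) :
    bstar (blkEE V + blkEI V * P * blkIE V) =
      blkEE (bstar V) + blkEI (bstar V) * Pᴴ * blkIE (bstar V) := by
  rw [blkEE_bstar, blkEI_bstar, blkIE_bstar]
  simp only [bstar, Matrix.conjTranspose_add, Matrix.conjTranspose_mul, Matrix.mul_add,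
    Matrix.add_mul, Matrix.mul_assoc]

/-- If `V` is a `⋆`-unitary Belavkin matrix whose middle indices are
partitioned into external (`n_e`) and internal (`n_i`) ones, `0 < n_i`, `0 < n_e`
(`n_e = n - n_i`), and `X` is a unitary `n_i × n_i` complex matrix with `1 - V_ii X`
invertible, then the feedback reduction `𝓕(V, X)` is again `⋆`-unitary. -/
theorem FRed_star_unitary (ne ni : ℕ) (hne : 0 < ne) (hni : 0 < ni)
    (V : Matrix (BIdx (Fin ne ⊕ Fin ni)) (BIdx (Fin ne ⊕ Fin ni)) (H₀ →L[ℂ] H₀))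
    (hV₁ : V * bstar V = 1) (hV₂ : bstar V * V = 1)
    (X : Matrix (Fin ni) (Fin ni) ℂ)
    (hX₁ : X * Xᴴ = 1) (hX₂ : Xᴴ * X = 1)
    (hinv : IsUnit (1 - blkII V * X.map (algebraMap ℂ (H₀ →L[ℂ] H₀)))) :
    FRed V X * bstar (FRed V X) = 1 ∧ bstar (FRed V X) * FRed V X = 1 := by
  set X' := X.map (algebraMap ℂ (H₀ →L[ℂ] H₀)) with hX'
  have hXstar : X'ᴴ = Xᴴ.map (algebraMap ℂ (H₀ →L[ℂ] H₀)) :=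
    (Matrix.conjTranspose_map _ fun c => algebraMap_star_comm c).symm
  have hXY : X' * X'ᴴ = 1 := by
    rw [hXstar, hX', ← Matrix.map_mul, hX₁, Matrix.map_one _ (map_zero _) (map_one _)]
  have hYX : X'ᴴ * X' = 1 := by
    rw [hXstar, hX', ← Matrix.map_mul, hX₂, Matrix.map_one _ (map_zero _) (map_one _)]
  set P := X' * Ring.inverse (1 - blkII V * X') with hPdef
  have hfac : 1 - blkII V * X' = (X'ᴴ - blkII V) * X' := by rw [Matrix.sub_mul, hYX]
  have hfac' : X'ᴴ - blkII V = (1 - blkII V * X') * X'ᴴ := by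
    rw [hfac, Matrix.mul_assoc, hXY, Matrix.mul_one]
  have hP₁ : (X'ᴴ - blkII V) * P = 1 := by
    rw [hPdef, ← Matrix.mul_assoc, ← hfac, Ring.mul_inverse_cancel _ hinv]
  have hP₂ : P * (X'ᴴ - blkII V) = 1 := by
    rw [hfac', hPdef, Matrix.mul_assoc, ← Matrix.mul_assoc (Ring.inverse _),
      Ring.inverse_mul_cancel _ hinv, Matrix.one_mul, hXY]
  have hQ₁ : (X' - blkII (bstar V)) * Pᴴ = 1 := by
    simpa [blkII_bstar] using congrArg Matrix.conjTranspose hP₂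
  have hQ₂ : Pᴴ * (X' - blkII (bstar V)) = 1 := by
    simpa [blkII_bstar] using congrArg Matrix.conjTranspose hP₁
  have hF : FRed V X = blkEE V + blkEI V * P * blkIE V := by
    rw [FRed, hPdef, hX', Matrix.mul_assoc (blkEI V)]
  rw [hF, bstar_blk_feedback]
  exact ⟨blk_feedback_mul_eq_one hV₁ hYX hP₂ hQ₁, blk_feedback_mul_eq_one hV₂ hXY hQ₂ hP₁⟩
end
end

section
/- Let S ∈ 𝔅^{n×n} be unitary, partitioned into blocks S_{ee}, S_{ei}, S_{ie}, S_{ii} according to a partition of {1,…,n} into external indices e (size n_e) and internal indices i (size n_i), with 0 < n_i < n. Let X be a unitary n_i×n_i complex matrix (regarded as scalar operators in 𝔅^{n_i×n_i}) such that X^{-1} - S_{ii} is invertible in 𝔅^{n_i×n_i}. Then the reduced scattering matrix S_red := S_{ee} + S_{ei}(X^{-1} - S_{ii})^{-1} S_{ie} is unitary in 𝔅^{n_e×n_e}. -/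
/-!
STATEMENT 6: for a unitary `S ∈ 𝔅^{n×n}` partitioned into blocks along
`{1,…,n} = e ⊔ i` and a unitary complex `n_i × n_i` matrix `X` with
`X⁻¹ - S_ii` invertible, the reduced scattering matrix
`S_red = S_ee + S_ei (X⁻¹ - S_ii)⁻¹ S_ie` is unitary in `𝔅^{n_e × n_e}`.
-/

noncomputable section

open scoped BigOperators Matrix

variable {H₀ : Type*} [NormedAddCommGroup H₀] [InnerProductSpace ℂ H₀] [CompleteSpace H₀]

open Matrix in
/-- Closing the internal channels of an isometric block matrix by an isometric feedback `Y`,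
with `Z` the internal amplitudes, yields an isometric matrix. -/
theorem Matrix.conjTranspose_mul_self_eq_one_of_feedback {R m n : Type*} [Ring R] [StarRing R]
    [Fintype m] [DecidableEq m] [Fintype n] [DecidableEq n]
    {S : Matrix (m ⊕ n) (m ⊕ n) R} (hS : Sᴴ * S = 1)
    {Y : Matrix n n R} (hY : Yᴴ * Y = 1) {Z : Matrix n m R}
    (hZ : (Y - S.toBlocks₂₂) * Z = S.toBlocks₂₁) :
    (S.toBlocks₁₁ + S.toBlocks₁₂ * Z)ᴴ * (S.toBlocks₁₁ + S.toBlocks₁₂ * Z) = 1 := by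
  have hYZ : S.toBlocks₂₁ + S.toBlocks₂₂ * Z = Y * Z := by
    rw [← hZ, Matrix.sub_mul, sub_add_cancel]
  have hSM : S * (fromRows 1 Z : Matrix (m ⊕ n) m R) = fromRows (S.toBlocks₁₁ + S.toBlocks₁₂ * Z) (Y * Z) := by
    conv_lhs => rw [← fromBlocks_toBlocks S]
    rw [fromBlocks_mul_fromRows, Matrix.mul_one, Matrix.mul_one, hYZ]
  have key : (S * (fromRows 1 Z : Matrix (m ⊕ n) m R))ᴴ * (S * (fromRows 1 Z : Matrix (m ⊕ n) m R)) =
      (fromRows 1 Z : Matrix (m ⊕ n) m R)ᴴ * (fromRows 1 Z : Matrix (m ⊕ n) m R) := by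
    rw [conjTranspose_mul, Matrix.mul_assoc, ← Matrix.mul_assoc Sᴴ, hS, Matrix.one_mul]
  have hYY : (Y * Z)ᴴ * (Y * Z) = Zᴴ * Z := by
    rw [conjTranspose_mul, Matrix.mul_assoc, ← Matrix.mul_assoc Yᴴ, hY, Matrix.one_mul]
  rw [hSM, conjTranspose_fromRows_eq_fromCols_conjTranspose,
    conjTranspose_fromRows_eq_fromCols_conjTranspose, fromCols_mul_fromRows,
    fromCols_mul_fromRows, hYY, conjTranspose_one, Matrix.mul_one] at key
  exact add_right_cancel key

/-- The reduced scattering matrix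
`S_red := S_ee + S_ei (X⁻¹ - S_ii)⁻¹ S_ie` of a unitary `S` is unitary. -/
theorem reduced_scattering_unitary (ne ni : ℕ) (hne : 0 < ne) (hni : 0 < ni)
    (S : Matrix (Fin ne ⊕ Fin ni) (Fin ne ⊕ Fin ni) (H₀ →L[ℂ] H₀))
    (hS₁ : S * Sᴴ = 1) (hS₂ : Sᴴ * S = 1)
    (X : Matrix (Fin ni) (Fin ni) ℂ)
    (hX₁ : X * Xᴴ = 1) (hX₂ : Xᴴ * X = 1)
    (hinv : IsUnit ((X⁻¹).map (algebraMap ℂ (H₀ →L[ℂ] H₀)) - S.toBlocks₂₂)) :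
    (S.toBlocks₁₁ +
        S.toBlocks₁₂ *
          Ring.inverse ((X⁻¹).map (algebraMap ℂ (H₀ →L[ℂ] H₀)) - S.toBlocks₂₂) *
          S.toBlocks₂₁) *
        (S.toBlocks₁₁ +
          S.toBlocks₁₂ *
            Ring.inverse ((X⁻¹).map (algebraMap ℂ (H₀ →L[ℂ] H₀)) - S.toBlocks₂₂) *
            S.toBlocks₂₁)ᴴ = 1 ∧
      (S.toBlocks₁₁ +
          S.toBlocks₁₂ *
            Ring.inverse ((X⁻¹).map (algebraMap ℂ (H₀ →L[ℂ] H₀)) - S.toBlocks₂₂) *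
            S.toBlocks₂₁)ᴴ *
        (S.toBlocks₁₁ +
          S.toBlocks₁₂ *
            Ring.inverse ((X⁻¹).map (algebraMap ℂ (H₀ →L[ℂ] H₀)) - S.toBlocks₂₂) *
            S.toBlocks₂₁) = 1 := by
  have hXinv : X⁻¹ = Xᴴ := Matrix.inv_eq_left_inv hX₂
  set Y := (X⁻¹).map (algebraMap ℂ (H₀ →L[ℂ] H₀)) with hYdef
  have hYstar : Yᴴ = X.map (algebraMap ℂ (H₀ →L[ℂ] H₀)) := by
    rw [hYdef, hXinv, ← Matrix.conjTranspose_map _ fun x => algebraMap_star_comm x,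
      Matrix.conjTranspose_conjTranspose]
  have hY₁ : Yᴴ * Y = 1 := by
    rw [hYstar, hYdef, hXinv, ← Matrix.map_mul, hX₁, Matrix.map_one _ (map_zero _) (map_one _)]
  have hY₂ : Y * Yᴴ = 1 := by
    rw [hYstar, hYdef, hXinv, ← Matrix.map_mul, hX₂, Matrix.map_one _ (map_zero _) (map_one _)]
  set W := Ring.inverse (Y - S.toBlocks₂₂) with hW
  have hW₁ : (Y - S.toBlocks₂₂) * W = 1 := Ring.mul_inverse_cancel _ hinv
  have hW₂ : W * (Y - S.toBlocks₂₂) = 1 := Ring.inverse_mul_cancel _ hinv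
  constructor
  · have h := Matrix.conjTranspose_mul_self_eq_one_of_feedback (S := Sᴴ) (Y := Yᴴ)
      (Z := (S.toBlocks₁₂ * W)ᴴ) (by rwa [Matrix.conjTranspose_conjTranspose])
      (by rwa [Matrix.conjTranspose_conjTranspose]) (by
        change (Yᴴ - S.toBlocks₂₂ᴴ) * _ = S.toBlocks₁₂ᴴ
        rw [← Matrix.conjTranspose_sub, ← Matrix.conjTranspose_mul, Matrix.mul_assoc, hW₂,
          Matrix.mul_one])
    change (S.toBlocks₁₁ᴴ + S.toBlocks₂₁ᴴ * _)ᴴ * (S.toBlocks₁₁ᴴ + S.toBlocks₂₁ᴴ * _) = 1 at h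
    rwa [← Matrix.conjTranspose_mul, ← Matrix.conjTranspose_add,
      Matrix.conjTranspose_conjTranspose] at h
  · rw [Matrix.mul_assoc S.toBlocks₁₂]
    refine Matrix.conjTranspose_mul_self_eq_one_of_feedback hS₂ hY₁ ?_
    rw [← Matrix.mul_assoc, hW₁, Matrix.one_mul]
end
end

section
/- Let V = V(S, L, H) be the Belavkin matrix in Hudson-Parthasarathy form with S ∈ 𝔅^{n×n} unitary, L a length-n column over 𝔅, H ∈ 𝔅 self-adjoint, with middle indices partitioned into external e (size n_e) and internal i (size n_i), 0 < n_i < n; write S = [[S_{ee}, S_{ei}],[S_{ie}, S_{ii}]] and L = [L_e; L_i]. Let X be a unitary n_i×n_i complex matrix such that 1 - S_{ii}X is invertible. Then the feedback-reduced matrix 𝓕(V, X) satisfies: 𝓕(V,X)_{00} = 1, 𝓕(V,X)_{0′0′} = 1, 𝓕(V,X)_{e0} = 0, 𝓕(V,X)_{0′0} = 0, 𝓕(V,X)_{0′e} = 0, and its middle blocks are 𝓕(V,X)_{ee} = S_{ee} + S_{ei}(X^{-1} - S_{ii})^{-1} S_{ie} and 𝓕(V,X)_{e0′} = L_e + S_{ei}(X^{-1}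 - S_{ii})^{-1} L_i. -/
noncomputable section

open scoped BigOperators Matrix

variable {H₀ : Type*} [NormedAddCommGroup H₀] [InnerProductSpace ℂ H₀] [CompleteSpace H₀]

/-- If `x` is invertible with inverse `y` and `1 - a * x` is a unit, then
`x * (1 - a * x)⁻¹ = (y - a)⁻¹`. -/
theorem mul_inverse_one_sub_mul {R : Type*} [Ring R] {a x y : R} (hxy : x * y = 1)
    (hyx : y * x = 1) (h : IsUnit (1 - a * x)) :
    x * Ring.inverse (1 - a * x) = Ring.inverse (y - a) := by
  obtain ⟨u, hu⟩ := h
  have hya : y - a = ↑(u * ⟨y, x, hyx, hxy⟩ : Rˣ) := by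
    simp [hu, sub_mul, mul_assoc, hxy]
  rw [hya, ← hu, Ring.inverse_unit, Ring.inverse_unit, mul_inv_rev, Units.val_mul]
  rfl

/-- The feedback reduction of a Hudson–Parthasarathy matrix by an invertible `X`, written with
`(X⁻¹ - S_ii)⁻¹`. -/
theorem FRed_HPmat_eq {ne ni : ℕ}
    (S : Matrix (Fin ne ⊕ Fin ni) (Fin ne ⊕ Fin ni) (H₀ →L[ℂ] H₀))
    (L : Fin ne ⊕ Fin ni → H₀ →L[ℂ] H₀) (H : H₀ →L[ℂ] H₀)
    (X : Matrix (Fin ni) (Fin ni) ℂ) (hX : IsUnit X.det)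
    (hinv : IsUnit (1 - blkII (HPmat S L H) * X.map (algebraMap ℂ (H₀ →L[ℂ] H₀)))) :
    FRed (HPmat S L H) X = blkEE (HPmat S L H) + blkEI (HPmat S L H) *
      Ring.inverse ((X⁻¹).map (algebraMap ℂ (H₀ →L[ℂ] H₀)) - S.toBlocks₂₂) *
      blkIE (HPmat S L H) := by
  have hone : (1 : Matrix (Fin ni) (Fin ni) ℂ).map (algebraMap ℂ (H₀ →L[ℂ] H₀)) = 1 :=
    Matrix.map_one _ (map_zero _) (map_one _)
  have hII : blkII (HPmat S L H) = S.toBlocks₂₂ := rfl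
  rw [FRed, Matrix.mul_assoc (blkEI _), mul_inverse_one_sub_mul _ _ hinv, hII]
  · rw [← Matrix.map_mul, Matrix.mul_nonsing_inv _ hX, hone]
  · rw [← Matrix.map_mul, Matrix.nonsing_inv_mul _ hX, hone]

/-- The feedback reduction of a Hudson–Parthasarathy Belavkin matrix
`V(S,L,H)` (middle indices partitioned as `e ⊔ i`) by a unitary complex matrix `X` with
`1 - S_ii X` invertible again has the Hudson–Parthasarathy shape, with reduced scattering
block `S_ee + S_ei (X⁻¹ - S_ii)⁻¹ S_ie` and reduced coupling block
`L_e + S_ei (X⁻¹ - S_ii)⁻¹ L_i`. -/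
theorem FRed_HPmat_blocks (ne ni : ℕ) (hne : 0 < ne) (hni : 0 < ni)
    (S : Matrix (Fin ne ⊕ Fin ni) (Fin ne ⊕ Fin ni) (H₀ →L[ℂ] H₀))
    (L : Fin ne ⊕ Fin ni → H₀ →L[ℂ] H₀) (H : H₀ →L[ℂ] H₀)
    (hS₁ : S * Sᴴ = 1) (hS₂ : Sᴴ * S = 1) (hH : IsSelfAdjoint H)
    (X : Matrix (Fin ni) (Fin ni) ℂ)
    (hX₁ : X * Xᴴ = 1) (hX₂ : Xᴴ * X = 1)
    (hinv : IsUnit (1 - blkII (HPmat S L H) * X.map (algebraMap ℂ (H₀ →L[ℂ] H₀)))) :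
    FRed (HPmat S L H) X (Sum.inl ()) (Sum.inl ()) = 1 ∧
      FRed (HPmat S L H) X (Sum.inr (Sum.inr ())) (Sum.inr (Sum.inr ())) = 1 ∧
      (∀ e : Fin ne, FRed (HPmat S L H) X (Sum.inr (Sum.inl e)) (Sum.inl ()) = 0) ∧
      FRed (HPmat S L H) X (Sum.inr (Sum.inr ())) (Sum.inl ()) = 0 ∧
      (∀ e : Fin ne, FRed (HPmat S L H) X (Sum.inr (Sum.inr ())) (Sum.inr (Sum.inl e)) = 0) ∧
      (∀ e e' : Fin ne,
        FRed (HPmat S L H) X (Sum.inr (Sum.inl e)) (Sum.inr (Sum.inl e')) =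
          (S.toBlocks₁₁ +
            S.toBlocks₁₂ *
              Ring.inverse ((X⁻¹).map (algebraMap ℂ (H₀ →L[ℂ] H₀)) - S.toBlocks₂₂) *
              S.toBlocks₂₁) e e') ∧
      (∀ e : Fin ne,
        FRed (HPmat S L H) X (Sum.inr (Sum.inl e)) (Sum.inr (Sum.inr ())) =
          L (Sum.inl e) +
            ∑ j : Fin ni,
              (S.toBlocks₁₂ *
                Ring.inverse ((X⁻¹).map (algebraMap ℂ (H₀ →L[ℂ] H₀)) - S.toBlocks₂₂)) e j *
                L (Sum.inr j)) := by
  rw [FRed_HPmat_eq S L H X (Matrix.isUnit_det_of_left_inverse hX₂) hinv]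
  set K := Ring.inverse ((X⁻¹).map (algebraMap ℂ (H₀ →L[ℂ] H₀)) - S.toBlocks₂₂)
  refine ⟨?_, ?_, fun e => ?_, ?_, fun e => ?_, fun e e' => ?_, fun e => ?_⟩ <;>
    simp [Matrix.mul_apply, blkEE, blkEI, blkIE, embE, intI, HPmat, Matrix.toBlocks₁₁,
      Matrix.toBlocks₁₂, Matrix.toBlocks₂₁]
end
end

section
/- Let V be a ⋆-unitary (1+n+1)×(1+n+1) Belavkin matrix over 𝔅 with middle indices partitioned into external e (size n_e) and internal i (size n_i), 0 < n_i < n, and let Φ(X) := 𝓕(V, X) for n_i×n_i complex matrices X with 1 - V_{ii}X invertible. Then for any X, Y in this domain with 1 - X†V_{ii}† also invertible, the following Siegel-type identity holds: Φ(X)⋆ Φ(Y) = 𝕀 + C⋆ (1 - X†V_{ii}†)^{-1} (X†Y - 1) (1 - V_{ii}Y)^{-1} C, where C is the (1+n_e+1)-rowed block column (V_{0i}; V_{ei}; V_{0′i}) with n_i columns, and C⋆ := J_{n_i} C† J_{n_e} (the extended ⋆-involution for rectangular Belavkin matrices). -/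
noncomputable section

open scoped BigOperators Matrix

variable {H₀ : Type*} [NormedAddCommGroup H₀] [InnerProductSpace ℂ H₀] [CompleteSpace H₀]

section Blocks

variable {R : Type*} {ne ni : ℕ}

theorem sum_BIdx_sum [AddCommMonoid R] (f : BIdx (Fin ne ⊕ Fin ni) → R) :
    ∑ c, f c = ∑ a, f (embE a) + ∑ j, f (intI j) := by
  simp only [Fintype.sum_sum_type, embE, intI]
  abel

theorem blkEE_mul_s8 [Semiring R]
    (M N : Matrix (BIdx (Fin ne ⊕ Fin ni)) (BIdx (Fin ne ⊕ Fin ni)) R) :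
    blkEE (M * N) = blkEE M * blkEE N + blkEI M * blkIE N := by
  ext a b
  simp only [blkEE, blkEI, blkIE, Matrix.of_apply, Matrix.mul_apply, Matrix.add_apply]
  exact sum_BIdx_sum _

theorem blkEI_mul_s8 [Semiring R]
    (M N : Matrix (BIdx (Fin ne ⊕ Fin ni)) (BIdx (Fin ne ⊕ Fin ni)) R) :
    blkEI (M * N) = blkEE M * blkEI N + blkEI M * blkII N := by
  ext a b
  simp only [blkEE, blkEI, blkII, Matrix.of_apply, Matrix.mul_apply, Matrix.add_apply]
  exact sum_BIdx_sum _

theorem blkIE_mul_s8 [Semiring R]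
    (M N : Matrix (BIdx (Fin ne ⊕ Fin ni)) (BIdx (Fin ne ⊕ Fin ni)) R) :
    blkIE (M * N) = blkIE M * blkEE N + blkII M * blkIE N := by
  ext a b
  simp only [blkEE, blkIE, blkII, Matrix.of_apply, Matrix.mul_apply, Matrix.add_apply]
  exact sum_BIdx_sum _

theorem blkII_mul_s8 [Semiring R]
    (M N : Matrix (BIdx (Fin ne ⊕ Fin ni)) (BIdx (Fin ne ⊕ Fin ni)) R) :
    blkII (M * N) = blkIE M * blkEI N + blkII M * blkII N := by
  ext a b
  simp only [blkEI, blkIE, blkII, Matrix.of_apply, Matrix.mul_apply, Matrix.add_apply]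
  exact sum_BIdx_sum _

theorem blkEE_Jmat [Zero R] [One R] :
    blkEE (Jmat R (Fin ne ⊕ Fin ni)) = Jmat R (Fin ne) := by
  ext (_ | _ | _) (_ | _ | _) <;> simp [blkEE, Jmat, embE]

theorem blkEI_Jmat [Zero R] [One R] : blkEI (Jmat R (Fin ne ⊕ Fin ni)) = 0 := by
  ext (_ | _ | _) _ <;> simp [blkEI, Jmat, embE, intI]

theorem blkIE_Jmat [Zero R] [One R] : blkIE (Jmat R (Fin ne ⊕ Fin ni)) = 0 := by
  ext _ (_ | _ | _) <;> simp [blkIE, Jmat, embE, intI]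

theorem blkII_Jmat [Zero R] [One R] : blkII (Jmat R (Fin ne ⊕ Fin ni)) = 1 := by
  ext _ _
  simp [blkII, Jmat, intI, Matrix.one_apply]

theorem Jmat_mul_self [Semiring R] {ι : Type*} [Fintype ι] [DecidableEq ι] :
    Jmat R ι * Jmat R ι = 1 := by
  ext (_ | _ | _) (_ | _ | _) <;>
    simp [Jmat, Matrix.mul_apply, Matrix.one_apply, Fintype.sum_sum_type]

variable [Ring R] [StarRing R]
  {V : Matrix (BIdx (Fin ne ⊕ Fin ni)) (BIdx (Fin ne ⊕ Fin ni)) R}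

theorem conjTranspose_mul_Jmat_mul_of_bstar_mul {ι : Type*} [Fintype ι] [DecidableEq ι]
    {W : Matrix (BIdx ι) (BIdx ι) R} (hW : bstar W * W = 1) :
    Wᴴ * (Jmat R ι * W) = Jmat R ι := by
  have h := congrArg (Jmat R ι * ·) hW
  simpa only [bstar, Matrix.mul_assoc, ← Matrix.mul_assoc (Jmat R ι) (Jmat R ι), Jmat_mul_self,
    Matrix.one_mul, Matrix.mul_one] using h

theorem blkEE_gram (hV : bstar V * V = 1) :
    (blkEE V)ᴴ * (Jmat R (Fin ne) * blkEE V) = Jmat R (Fin ne) - (blkIE V)ᴴ * blkIE V := by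
  have h := congrArg blkEE (conjTranspose_mul_Jmat_mul_of_bstar_mul hV)
  rw [blkEE_mul_s8, blkEE_mul_s8, blkIE_mul_s8, blkEE_Jmat, blkEI_Jmat, blkIE_Jmat, blkII_Jmat] at h
  simp only [Matrix.zero_mul, add_zero, zero_add, Matrix.one_mul] at h
  exact eq_sub_of_add_eq h

theorem blkEI_gram (hV : bstar V * V = 1) :
    (blkEE V)ᴴ * (Jmat R (Fin ne) * blkEI V) = -((blkIE V)ᴴ * blkII V) := by
  have h := congrArg blkEI (conjTranspose_mul_Jmat_mul_of_bstar_mul hV)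
  rw [blkEI_mul_s8, blkEI_mul_s8, blkII_mul_s8, blkEE_Jmat, blkEI_Jmat, blkIE_Jmat, blkII_Jmat] at h
  simp only [Matrix.zero_mul, add_zero, zero_add, Matrix.one_mul] at h
  exact eq_neg_of_add_eq_zero_left h

theorem blkIE_gram (hV : bstar V * V = 1) :
    (blkEI V)ᴴ * (Jmat R (Fin ne) * blkEE V) = -((blkII V)ᴴ * blkIE V) := by
  have h := congrArg blkIE (conjTranspose_mul_Jmat_mul_of_bstar_mul hV)
  rw [blkIE_mul_s8, blkEE_mul_s8, blkIE_mul_s8, blkEE_Jmat, blkEI_Jmat, blkIE_Jmat, blkII_Jmat] at h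
  simp only [Matrix.zero_mul, add_zero, zero_add, Matrix.one_mul] at h
  exact eq_neg_of_add_eq_zero_left h

theorem blkII_gram (hV : bstar V * V = 1) :
    (blkEI V)ᴴ * (Jmat R (Fin ne) * blkEI V) = 1 - (blkII V)ᴴ * blkII V := by
  have h := congrArg blkII (conjTranspose_mul_Jmat_mul_of_bstar_mul hV)
  rw [blkII_mul_s8, blkEI_mul_s8, blkII_mul_s8, blkEE_Jmat, blkEI_Jmat, blkIE_Jmat, blkII_Jmat] at h
  simp only [Matrix.zero_mul, add_zero, zero_add, Matrix.one_mul] at h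
  exact eq_sub_of_add_eq h

/-- The sesquilinear form `Jmat` on graphs `u ↦ V_{EE} + V_{EI} u` of internal signals. -/
theorem conjTranspose_mul_Jmat_mul_add (hV : bstar V * V = 1)
    (w u : Matrix (Fin ni) (BIdx (Fin ne)) R) :
    (blkEE V + blkEI V * w)ᴴ * (Jmat R (Fin ne) * (blkEE V + blkEI V * u)) =
      Jmat R (Fin ne) + wᴴ * u - (blkIE V + blkII V * w)ᴴ * (blkIE V + blkII V * u) := by
  have h₁ := congrArg (· * u) (blkEI_gram hV)
  have h₂ := congrArg (wᴴ * ·) (blkIE_gram hV)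
  have h₃ := congrArg (wᴴ * · * u) (blkII_gram hV)
  simp only [Matrix.mul_assoc, Matrix.mul_sub, Matrix.sub_mul, Matrix.mul_neg, Matrix.neg_mul,
    Matrix.one_mul] at h₁ h₂ h₃
  simp only [Matrix.conjTranspose_add, Matrix.conjTranspose_mul, Matrix.add_mul, Matrix.mul_add,
    Matrix.mul_assoc, blkEE_gram hV, h₁, h₂, h₃]
  abel

end Blocks

theorem add_mul_inverse_one_sub {S : Type*} [Ring S] {a y : S} (h : IsUnit (1 - a * y)) :
    1 + a * (y * Ring.inverse (1 - a * y)) = Ring.inverse (1 - a * y) := by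
  have h' := Ring.mul_inverse_cancel _ h
  rw [sub_mul, one_mul, sub_eq_iff_eq_add, mul_assoc] at h'
  exact h'.symm

theorem conjTranspose_map_algebraMap {A m n : Type*} [Semiring A] [StarRing A] [Algebra ℂ A]
    [StarModule ℂ A] (X : Matrix m n ℂ) :
    (X.map (algebraMap ℂ A))ᴴ = Xᴴ.map (algebraMap ℂ A) :=
  (Matrix.conjTranspose_map _ fun z => algebraMap_star_comm z).symm

/-- first Siegel-type identity.  For `Φ(X) := 𝓕(V, X)` with `V`
`⋆`-unitary one has
`Φ(X)⋆ Φ(Y) = 𝕀 + B⋆ (1 - X†V_ii†)⁻¹ (X†Y - 1) (1 - V_ii Y)⁻¹ B`,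
where `B` collects the sub-blocks of `V` whose indices run over the internal set on one
side and over `{0} ∪ e ∪ {0′}` on the other (the blocks `V_i0, V_ie, V_i0′` / their column
counterparts `V_0i, V_ei, V_0′i` of the statement; matrix shapes dictate that the right
factor is the block row `(V_i0, V_ie, V_i0′)` of shape `n_i × (1+n_e+1)`), and
`B⋆ = J_{n_e} B† J_{n_i}` is the extended `⋆`-involution for rectangular Belavkin
matrices, `J` on the bare internal index set being the `n_i × n_i` identity. -/
theorem FRed_siegel_first (ne ni : ℕ) (hne : 0 < ne) (hni : 0 < ni)
    (V : Matrix (BIdx (Fin ne ⊕ Fin ni)) (BIdx (Fin ne ⊕ Fin ni)) (H₀ →L[ℂ] H₀))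
    (hV₁ : V * bstar V = 1) (hV₂ : bstar V * V = 1)
    (X Y : Matrix (Fin ni) (Fin ni) ℂ)
    (hX : IsUnit (1 - blkII V * X.map (algebraMap ℂ (H₀ →L[ℂ] H₀))))
    (hY : IsUnit (1 - blkII V * Y.map (algebraMap ℂ (H₀ →L[ℂ] H₀))))
    (hX' : IsUnit (1 - (Xᴴ).map (algebraMap ℂ (H₀ →L[ℂ] H₀)) * (blkII V)ᴴ)) :
    bstar (FRed V X) * FRed V Y =
      1 + (Jmat (H₀ →L[ℂ] H₀) (Fin ne) * (blkIE V)ᴴ * (1 : Matrix (Fin ni) (Fin ni) (H₀ →L[ℂ] H₀))) *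
          Ring.inverse (1 - (Xᴴ).map (algebraMap ℂ (H₀ →L[ℂ] H₀)) * (blkII V)ᴴ) *
          ((Xᴴ).map (algebraMap ℂ (H₀ →L[ℂ] H₀)) * Y.map (algebraMap ℂ (H₀ →L[ℂ] H₀)) - 1) *
          Ring.inverse (1 - blkII V * Y.map (algebraMap ℂ (H₀ →L[ℂ] H₀))) *
          blkIE V := by
  have hinv : (Ring.inverse (1 - blkII V * X.map (algebraMap ℂ (H₀ →L[ℂ] H₀))))ᴴ =
      Ring.inverse (1 - (Xᴴ).map (algebraMap ℂ (H₀ →L[ℂ] H₀)) * (blkII V)ᴴ) := by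
    rw [← Matrix.star_eq_conjTranspose, ← Ring.inverse_star, Matrix.star_eq_conjTranspose,
      Matrix.conjTranspose_sub, Matrix.conjTranspose_one, Matrix.conjTranspose_mul,
      conjTranspose_map_algebraMap]
  have resolvent : ∀ {Z : Matrix (Fin ni) (Fin ni) (H₀ →L[ℂ] H₀)}, IsUnit (1 - blkII V * Z) →
      blkIE V + blkII V * (Z * (Ring.inverse (1 - blkII V * Z) * blkIE V)) =
        Ring.inverse (1 - blkII V * Z) * blkIE V := by
    intro Z hZ
    conv_rhs => rw [← add_mul_inverse_one_sub hZ]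
    simp only [Matrix.add_mul, Matrix.one_mul, Matrix.mul_assoc]
  have key := congrArg (Jmat (H₀ →L[ℂ] H₀) (Fin ne) * ·) (conjTranspose_mul_Jmat_mul_add hV₂
    (X.map (algebraMap ℂ (H₀ →L[ℂ] H₀)) *
      (Ring.inverse (1 - blkII V * X.map (algebraMap ℂ (H₀ →L[ℂ] H₀))) * blkIE V))
    (Y.map (algebraMap ℂ (H₀ →L[ℂ] H₀)) *
      (Ring.inverse (1 - blkII V * Y.map (algebraMap ℂ (H₀ →L[ℂ] H₀))) * blkIE V)))
  simp only [resolvent hX, resolvent hY] at key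
  simp only [bstar, FRed, Matrix.mul_assoc] at key ⊢
  rw [key]
  simp only [Matrix.conjTranspose_mul, conjTranspose_map_algebraMap, hinv, Matrix.mul_add,
    Matrix.mul_sub, Matrix.sub_mul, Matrix.mul_assoc, Jmat_mul_self, Matrix.one_mul]
  abel
end
end
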